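/- arXiv:1505.08055 — 2 statements merged into one kernel-verified Lean document; each statement's English description precedes it below -/
import Mathlib

section
/- Let d be a positive rational with 1.5 < √d < 2 and √d irrational. Then the restriction of λ_√d (the map x ↦ √d·x) to ℕ is first-order definable without parameters in the structure R_√d = (ℝ; <, +, ℤ, ℤ√d); that is, the set {(n, n√d) : n ∈ ℕ} ⊆ ℝ² is definable in R_√d. -/
open FirstOrder

/-- The language of `R_√d`: a binary function `+`, a binary relation `<`,
and two unary predicates (for `ℤ` and for `ℤ√d`). -/
def rLang : FirstOrder.Language where
  Functions := fun n => match n with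
    | 2 => Unit
    | _ => Empty
  Relations := fun n => match n with
    | 1 => Bool
    | 2 => Unit
    | _ => Empty

/-- The structure `R_√d = (ℝ; <, +, ℤ, ℤ√d)`. -/
def rStruc (d : ℚ) : rLang.Structure ℝ where
  funMap {n} f v :=
    match n, f, v with
    | 2, _, v => v 0 + v 1
  RelMap {n} r v :=
    match n, r, v with
    | 1, false, v => ∃ z : ℤ, v 0 = (z : ℝ)
    | 1, true, v => ∃ z : ℤ, v 0 = (z : ℝ) * Real.sqrt d
    | 2, _, v => v 0 < v 1

section Definability

variable {d : ℚ} {n : ℕ}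

/-- The symbol for addition. -/
def addSymbol : rLang.Functions 2 := (() : Unit)

/-- The symbol for the order. -/
def ltSymbol : rLang.Relations 2 := (() : Unit)

/-- The symbol for `ℤ` (`false`) or `ℤ√d` (`true`). -/
def latticeSymbol (b : Bool) : rLang.Relations 1 := b

/-- `f` is the interpretation of a term in `n` variables. -/
def IsTerm (d : ℚ) {n : ℕ} (f : (Fin n → ℝ) → ℝ) : Prop :=
  letI := rStruc d
  ∃ t : rLang.Term (Empty ⊕ Fin n), ∀ v : Fin n → ℝ, t.realize (Sum.elim default v) = f v

/-- `P` is the interpretation of a formula in `n` variables. -/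
def DefPred (d : ℚ) {n : ℕ} (P : (Fin n → ℝ) → Prop) : Prop :=
  letI := rStruc d
  ∃ φ : rLang.BoundedFormula Empty n, ∀ v : Fin n → ℝ, φ.Realize default v ↔ P v

theorem IsTerm.var (i : Fin n) : IsTerm d (fun v => v i) :=
  ⟨FirstOrder.Language.Term.var (Sum.inr i), fun _ => rfl⟩

theorem IsTerm.init {f : (Fin n → ℝ) → ℝ} (hf : IsTerm d f) :
    IsTerm d (fun w : Fin (n + 1) → ℝ => f (Fin.init w)) := by
  let := rStruc d
  obtain ⟨t, ht⟩ := hf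
  refine ⟨t.relabel (Sum.map id Fin.castSucc), fun v => ?_⟩
  rw [FirstOrder.Language.Term.realize_relabel]
  refine Eq.trans ?_ (ht _)
  congr 1
  funext x
  rcases x with x | x
  · exact x.elim
  · rfl

theorem IsTerm.add {f g : (Fin n → ℝ) → ℝ} (hf : IsTerm d f) (hg : IsTerm d g) :
    IsTerm d (fun v => f v + g v) := by
  let := rStruc d
  obtain ⟨t, ht⟩ := hf
  obtain ⟨s, hs⟩ := hg
  refine ⟨FirstOrder.Language.Term.func addSymbol ![t, s], fun v => ?_⟩
  exact congrArg₂ (· + ·) (ht v) (hs v)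

theorem IsTerm.natCast_mul {f : (Fin n → ℝ) → ℝ} (hf : IsTerm d f) {c : ℕ} (hc : 0 < c) :
    IsTerm d (fun v => (c : ℝ) * f v) := by
  induction c, hc using Nat.le_induction with
  | base => simpa using hf
  | succ c _ ih =>
    have := ih.add hf
    push_cast
    simpa only [add_mul, one_mul] using this

theorem DefPred.congr {P Q : (Fin n → ℝ) → Prop} (hP : DefPred d P) (h : ∀ v, P v ↔ Q v) :
    DefPred d Q := by
  obtain ⟨φ, hφ⟩ := hP
  exact ⟨φ, fun v => (hφ v).trans (h v)⟩

theorem DefPred.not {P : (Fin n → ℝ) → Prop} (hP : DefPred d P) : DefPred d (fun v => ¬ P v) := by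
  let := rStruc d
  obtain ⟨φ, hφ⟩ := hP
  exact ⟨φ.not, fun v => by
    rw [FirstOrder.Language.BoundedFormula.realize_not]; exact not_congr (hφ v)⟩

theorem DefPred.and {P Q : (Fin n → ℝ) → Prop} (hP : DefPred d P) (hQ : DefPred d Q) :
    DefPred d (fun v => P v ∧ Q v) := by
  let := rStruc d
  obtain ⟨φ, hφ⟩ := hP
  obtain ⟨ψ, hψ⟩ := hQ
  exact ⟨φ ⊓ ψ, fun v => by
    rw [FirstOrder.Language.BoundedFormula.realize_inf]; exact and_congr (hφ v) (hψ v)⟩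

theorem DefPred.or {P Q : (Fin n → ℝ) → Prop} (hP : DefPred d P) (hQ : DefPred d Q) :
    DefPred d (fun v => P v ∨ Q v) :=
  (hP.not.and hQ.not).not.congr fun v => by tauto

theorem DefPred.imp {P Q : (Fin n → ℝ) → Prop} (hP : DefPred d P) (hQ : DefPred d Q) :
    DefPred d (fun v => P v → Q v) :=
  (hP.and hQ.not).not.congr fun v => by tauto

theorem DefPred.exists {Q : (Fin n → ℝ) → ℝ → Prop}
    (hQ : DefPred d (fun w : Fin (n + 1) → ℝ => Q (Fin.init w) (w (Fin.last n)))) :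
    DefPred d (fun v => ∃ x, Q v x) := by
  let := rStruc d
  obtain ⟨φ, hφ⟩ := hQ
  refine ⟨φ.ex, fun v => ?_⟩
  rw [FirstOrder.Language.BoundedFormula.realize_ex]
  refine exists_congr fun x => ?_
  refine (hφ _).trans ?_
  simp only [Fin.init_snoc, Fin.snoc_last]

theorem DefPred.forall {Q : (Fin n → ℝ) → ℝ → Prop}
    (hQ : DefPred d (fun w : Fin (n + 1) → ℝ => Q (Fin.init w) (w (Fin.last n)))) :
    DefPred d (fun v => ∀ x, Q v x) :=
  (DefPred.exists (Q := fun v x => ¬ Q v x) hQ.not).not.congr fun v => by simp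

theorem IsTerm.eq {f g : (Fin n → ℝ) → ℝ} (hf : IsTerm d f) (hg : IsTerm d g) :
    DefPred d (fun v => f v = g v) := by
  let := rStruc d
  obtain ⟨t, ht⟩ := hf
  obtain ⟨s, hs⟩ := hg
  refine ⟨t.bdEqual s, fun v => ?_⟩
  rw [FirstOrder.Language.BoundedFormula.realize_bdEqual, ht, hs]

theorem IsTerm.lt {f g : (Fin n → ℝ) → ℝ} (hf : IsTerm d f) (hg : IsTerm d g) :
    DefPred d (fun v => f v < g v) := by
  let := rStruc d
  obtain ⟨t, ht⟩ := hf
  obtain ⟨s, hs⟩ := hg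
  refine ⟨FirstOrder.Language.Relations.boundedFormula₂ ltSymbol t s,
    fun v => ?_⟩
  rw [FirstOrder.Language.BoundedFormula.realize_rel₂, ht, hs]
  exact Iff.rfl

theorem IsTerm.le {f g : (Fin n → ℝ) → ℝ} (hf : IsTerm d f) (hg : IsTerm d g) :
    DefPred d (fun v => f v ≤ g v) :=
  (hg.lt hf).not.congr fun _ => not_lt

theorem IsTerm.pos {f : (Fin n → ℝ) → ℝ} (hf : IsTerm d f) : DefPred d (fun v => 0 < f v) :=
  (hf.lt (hf.add hf)).congr fun _ => by simp

theorem IsTerm.nonneg {f : (Fin n → ℝ) → ℝ} (hf : IsTerm d f) : DefPred d (fun v => 0 ≤ f v) :=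
  (hf.le (hf.add hf)).congr fun _ => by simp

theorem DefPred.exists_lt {P : ℕ → (Fin n → ℝ) → Prop} (hP : ∀ c, DefPred d (P c)) (K : ℕ) :
    DefPred d (fun v => ∃ c < K, P c v) := by
  induction K with
  | zero => exact ((hP 0).and (hP 0).not).congr fun v => by simp
  | succ K ih => exact (ih.or (hP K)).congr fun v => Nat.exists_lt_succ_right.symm

/-- `x` lies in the lattice `ℤ c`. -/
def InLattice (c x : ℝ) : Prop := ∃ z : ℤ, x = (z : ℝ) * c

/-- The lattice `ℤ c` is definable. -/
def DefLattice (d : ℚ) (c : ℝ) : Prop :=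
  ∀ {n : ℕ} {f : (Fin n → ℝ) → ℝ}, IsTerm d f → DefPred d (fun v => InLattice c (f v))

theorem defLattice_one : DefLattice d 1 := by
  intro n f hf
  let := rStruc d
  obtain ⟨t, ht⟩ := hf
  refine ⟨FirstOrder.Language.Relations.boundedFormula₁ (latticeSymbol false) t,
    fun v => ?_⟩
  rw [FirstOrder.Language.BoundedFormula.realize_rel₁, ht]
  simp only [InLattice, mul_one]
  exact Iff.rfl

theorem defLattice_sqrt : DefLattice d (Real.sqrt d) := by
  intro n f hf
  let := rStruc d
  obtain ⟨t, ht⟩ := hf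
  refine ⟨FirstOrder.Language.Relations.boundedFormula₁ (latticeSymbol true) t,
    fun v => ?_⟩
  rw [FirstOrder.Language.BoundedFormula.realize_rel₁, ht]
  exact Iff.rfl

theorem defLattice_ratCast (hd : 0 < d) : DefLattice d (d : ℝ) := by
  intro n f hf
  have hp : 0 < d.num.toNat := by
    have := Rat.num_pos.2 hd
    omega
  have hcast : ((d.num.toNat : ℕ) : ℝ) = (d.num : ℝ) := by
    have : ((d.num.toNat : ℕ) : ℤ) = d.num := Int.toNat_of_nonneg (Rat.num_pos.2 hd).le
    exact_mod_cast this
  have hq : (d.den : ℝ) ≠ 0 := by exact_mod_cast d.den_ne_zero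
  refine (DefPred.exists (Q := fun v x => InLattice 1 x ∧
    (d.den : ℝ) * f v = ((d.num.toNat : ℕ) : ℝ) * x)
    ((defLattice_one (IsTerm.var _)).and
      ((hf.init.natCast_mul d.den_pos).eq ((IsTerm.var _).natCast_mul hp)))).congr fun v => ?_
  have key : ∀ z : ℤ, (d.den : ℝ) * f v = (d.num : ℝ) * z ↔ f v = z * d := by
    intro z
    rw [Rat.cast_def d]
    field_simp
  simp only [InLattice, mul_one, hcast]
  constructor
  · rintro ⟨_, ⟨z, rfl⟩, h⟩
    exact ⟨z, (key z).1 h⟩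
  · rintro ⟨z, h⟩
    exact ⟨z, ⟨z, rfl⟩, (key z).2 h⟩

theorem DefPred.definable₂ {P : ℝ → ℝ → Prop}
    (hP : DefPred d (fun v : Fin 2 → ℝ => P (v 0) (v 1))) :
    letI := rStruc d
    Set.Definable₂ (∅ : Set ℝ) rLang {p : ℝ × ℝ | P p.1 p.2} := by
  let := rStruc d
  obtain ⟨φ, hφ⟩ := hP
  refine Set.empty_definable_iff.2 ⟨φ.toFormula.relabel (Sum.elim (fun e => e.elim) id), ?_⟩
  ext v
  refine Iff.trans (hφ v).symm ?_
  change _ ↔ (FirstOrder.Language.Formula.relabel _ _).Realize v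
  rw [FirstOrder.Language.Formula.realize_relabel,
    FirstOrder.Language.BoundedFormula.realize_toFormula]
  rw [Subsingleton.elim (default : Empty → ℝ)]
  rfl

/-- With `N ∈ ℤ a` and `N + j ∈ ℤ b`, the distance `j` from `N` to `ℤ b` is a best approximation
from above: no positive element of `ℤ a` up to `N` is closer than `j` to `ℤ b`. -/
def IsApprox (a b N j : ℝ) : Prop :=
  InLattice a N ∧ 0 < N ∧ 0 < j ∧ InLattice b (N + j) ∧
    ∀ M, ∀ y, InLattice a M ∧ InLattice b y ∧ 0 < M ∧ M ≤ N → j + y ≤ M ∨ j + M ≤ y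

/-- Modulo `ℤ b`, the number `x - t` lies in `[0, j)`. -/
def IsNear (b x j t : ℝ) : Prop := ∃ y, InLattice b y ∧ t + y ≤ x ∧ x < t + y + j

/-- `t` is the first element of `ℕ a` such that `x - t` lies in `[0, j)` modulo `ℤ b`. -/
def IsFirstNear (a b x j t : ℝ) : Prop :=
  InLattice a t ∧ 0 ≤ t ∧ IsNear b x j t ∧
    ∀ s, InLattice a s ∧ 0 ≤ s ∧ s < t → ¬ IsNear b x j s

/-- A best approximation of `ℤ a` by `ℤ b` and the next larger one of `ℤ b` by `ℤ c`. -/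
def IsMatch (a b c N j M i : ℝ) : Prop :=
  IsApprox a b N j ∧ IsApprox b c M i ∧ j < i ∧
    ∀ L, ∀ h, IsApprox b c L h → ¬ (j < h ∧ h < i)

/-- Consecutive best approximations. -/
def IsNext (a b N₁ j₁ N₂ j₂ : ℝ) : Prop :=
  IsApprox a b N₁ j₁ ∧ IsApprox a b N₂ j₂ ∧ N₁ < N₂ ∧
    ∀ N, ∀ j, IsApprox a b N j → ¬ (N₁ < N ∧ N < N₂)

/-- The best approximation with the smallest `N`. -/
def IsInitial (a b N j : ℝ) : Prop :=
  IsApprox a b N j ∧ ∀ M, ∀ i, IsApprox a b M i → ¬ M < N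

/-- `t` and `s` are the same multiple of `N` and `M`. -/
def SameMultiple (K : ℕ) (N t M s : ℝ) : Prop :=
  ∃ c < K, t + N = ((c + 1 : ℕ) : ℝ) * N ∧ s + M = ((c + 1 : ℕ) : ℝ) * M

/-- `t₂ - t₁` and `s₂ - s₁` are the same rational combination of `N₁, N₂` and `M₁, M₂`, with
numerators and denominators bounded in terms of `K`. -/
def SameCombination (K : ℕ) (N₁ N₂ t₁ t₂ M₁ M₂ s₁ s₂ : ℝ) : Prop :=
  ∃ D < K, ∃ a < K, ∃ a' < K, ∃ b < K, ∃ b' < K,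
    ((D + 1 : ℕ) : ℝ) * t₂ + ((a + 1 : ℕ) : ℝ) * N₁ + ((b + 1 : ℕ) : ℝ) * N₂ =
      ((D + 1 : ℕ) : ℝ) * t₁ + ((a' + 1 : ℕ) : ℝ) * N₁ + ((b' + 1 : ℕ) : ℝ) * N₂ ∧
    ((D + 1 : ℕ) : ℝ) * s₂ + ((a + 1 : ℕ) : ℝ) * M₁ + ((b + 1 : ℕ) : ℝ) * M₂ =
      ((D + 1 : ℕ) : ℝ) * s₁ + ((a' + 1 : ℕ) : ℝ) * M₁ + ((b' + 1 : ℕ) : ℝ) * M₂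

/-- `x ∈ ℕ a` and `x' ∈ ℕ b` have the same expansion along the best approximations of `ℤ a` by
`ℤ b` and of `ℤ b` by `ℤ c`. -/
def SameExpansion (K : ℕ) (a b c x x' : ℝ) : Prop :=
  InLattice a x ∧ 0 ≤ x ∧ InLattice b x' ∧ 0 ≤ x' ∧
  (∀ N, ∀ j, ∀ N', ∀ j', ∀ t, ∀ t',
    IsInitial a b N j ∧ IsMatch a b c N j N' j' ∧
      IsFirstNear a b x j t ∧ IsFirstNear b c x' j' t' → SameMultiple K N t N' t') ∧
  (∀ N₁, ∀ j₁, ∀ N₁', ∀ j₁', ∀ t₁, ∀ t₁', ∀ N₂, ∀ j₂, ∀ N₂', ∀ j₂', ∀ t₂, ∀ t₂',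
    IsNext a b N₁ j₁ N₂ j₂ ∧ IsMatch a b c N₁ j₁ N₁' j₁' ∧ IsMatch a b c N₂ j₂ N₂' j₂' ∧
      IsFirstNear a b x j₁ t₁ ∧ IsFirstNear b c x' j₁' t₁' ∧
      IsFirstNear a b x j₂ t₂ ∧ IsFirstNear b c x' j₂' t₂' →
    SameCombination K N₁ N₂ t₁ t₂ N₁' N₂' t₁' t₂')

section

variable {a b c : ℝ}

theorem IsTerm.isApprox (ha : DefLattice d a) (hb : DefLattice d b) {N j : (Fin n → ℝ) → ℝ}
    (hN : IsTerm d N) (hj : IsTerm d j) : DefPred d (fun v => IsApprox a b (N v) (j v)) := by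
  refine (ha hN).and (hN.pos.and (hj.pos.and ((hb (hN.add hj)).and ?_)))
  refine DefPred.forall (DefPred.forall (DefPred.imp ?_ ?_))
  · exact (ha (IsTerm.var _)).and ((hb (IsTerm.var _)).and
      ((IsTerm.var _).pos.and ((IsTerm.var _).le hN.init.init)))
  · exact ((hj.init.init.add (IsTerm.var _)).le (IsTerm.var _)).or
      ((hj.init.init.add (IsTerm.var _)).le (IsTerm.var _))

theorem IsTerm.isNear (hb : DefLattice d b) {x j t : (Fin n → ℝ) → ℝ}
    (hx : IsTerm d x) (hj : IsTerm d j) (ht : IsTerm d t) :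
    DefPred d (fun v => IsNear b (x v) (j v) (t v)) :=
  DefPred.exists ((hb (IsTerm.var _)).and (((ht.init.add (IsTerm.var _)).le hx.init).and
    (hx.init.lt ((ht.init.add (IsTerm.var _)).add hj.init))))

theorem IsTerm.isFirstNear (ha : DefLattice d a) (hb : DefLattice d b) {x j t : (Fin n → ℝ) → ℝ}
    (hx : IsTerm d x) (hj : IsTerm d j) (ht : IsTerm d t) :
    DefPred d (fun v => IsFirstNear a b (x v) (j v) (t v)) := by
  refine (ha ht).and (ht.nonneg.and ((hx.isNear hb hj ht).and (DefPred.forall (DefPred.imp ?_ ?_))))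
  · exact (ha (IsTerm.var _)).and ((IsTerm.var _).nonneg.and ((IsTerm.var _).lt ht.init))
  · exact (hx.init.isNear hb hj.init (IsTerm.var _)).not

theorem IsTerm.isMatch (ha : DefLattice d a) (hb : DefLattice d b) (hc : DefLattice d c)
    {N j N' j' : (Fin n → ℝ) → ℝ} (hN : IsTerm d N) (hj : IsTerm d j) (hN' : IsTerm d N')
    (hj' : IsTerm d j') : DefPred d (fun v => IsMatch a b c (N v) (j v) (N' v) (j' v)) := by
  refine (hN.isApprox ha hb hj).and ((hN'.isApprox hb hc hj').and ((hj.lt hj').and ?_))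
  refine DefPred.forall (DefPred.forall (DefPred.imp ?_ ?_))
  · exact (IsTerm.var _).isApprox hb hc (IsTerm.var _)
  · exact ((hj.init.init.lt (IsTerm.var _)).and ((IsTerm.var _).lt hj'.init.init)).not

theorem IsTerm.isNext (ha : DefLattice d a) (hb : DefLattice d b)
    {N₁ j₁ N₂ j₂ : (Fin n → ℝ) → ℝ} (hN₁ : IsTerm d N₁) (hj₁ : IsTerm d j₁) (hN₂ : IsTerm d N₂)
    (hj₂ : IsTerm d j₂) : DefPred d (fun v => IsNext a b (N₁ v) (j₁ v) (N₂ v) (j₂ v)) := by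
  refine (hN₁.isApprox ha hb hj₁).and ((hN₂.isApprox ha hb hj₂).and ((hN₁.lt hN₂).and ?_))
  refine DefPred.forall (DefPred.forall (DefPred.imp ?_ ?_))
  · exact (IsTerm.var _).isApprox ha hb (IsTerm.var _)
  · exact ((hN₁.init.init.lt (IsTerm.var _)).and ((IsTerm.var _).lt hN₂.init.init)).not

theorem IsTerm.isInitial (ha : DefLattice d a) (hb : DefLattice d b) {N j : (Fin n → ℝ) → ℝ}
    (hN : IsTerm d N) (hj : IsTerm d j) : DefPred d (fun v => IsInitial a b (N v) (j v)) := by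
  refine (hN.isApprox ha hb hj).and (DefPred.forall (DefPred.forall (DefPred.imp ?_ ?_)))
  · exact (IsTerm.var _).isApprox ha hb (IsTerm.var _)
  · exact ((IsTerm.var _).lt hN.init.init).not

theorem IsTerm.sameMultiple (K : ℕ) {N t N' t' : (Fin n → ℝ) → ℝ} (hN : IsTerm d N)
    (ht : IsTerm d t) (hN' : IsTerm d N') (ht' : IsTerm d t') :
    DefPred d (fun v => SameMultiple K (N v) (t v) (N' v) (t' v)) :=
  DefPred.exists_lt (fun m => ((ht.add hN).eq (hN.natCast_mul m.succ_pos)).and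
    ((ht'.add hN').eq (hN'.natCast_mul m.succ_pos))) K

theorem IsTerm.sameCombination (K : ℕ) {N₁ N₂ t₁ t₂ N₁' N₂' t₁' t₂' : (Fin n → ℝ) → ℝ}
    (hN₁ : IsTerm d N₁) (hN₂ : IsTerm d N₂) (ht₁ : IsTerm d t₁) (ht₂ : IsTerm d t₂)
    (hN₁' : IsTerm d N₁') (hN₂' : IsTerm d N₂') (ht₁' : IsTerm d t₁') (ht₂' : IsTerm d t₂') :
    DefPred d (fun v => SameCombination K (N₁ v) (N₂ v) (t₁ v) (t₂ v)
      (N₁' v) (N₂' v) (t₁' v) (t₂' v)) := by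
  refine DefPred.exists_lt (fun D => ?_) K
  refine DefPred.exists_lt (fun a => ?_) K
  refine DefPred.exists_lt (fun a' => ?_) K
  refine DefPred.exists_lt (fun b => ?_) K
  refine DefPred.exists_lt (fun b' => ?_) K
  have hcomb : ∀ {f g h : (Fin n → ℝ) → ℝ} (x y : ℕ), IsTerm d f → IsTerm d g → IsTerm d h →
      IsTerm d (fun v => ((D + 1 : ℕ) : ℝ) * f v + ((x + 1 : ℕ) : ℝ) * g v +
        ((y + 1 : ℕ) : ℝ) * h v) := fun x y hf hg hh =>
    ((hf.natCast_mul D.succ_pos).add (hg.natCast_mul x.succ_pos)).add (hh.natCast_mul y.succ_pos)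
  exact ((hcomb a b ht₂ hN₁ hN₂).eq (hcomb a' b' ht₁ hN₁ hN₂)).and
    ((hcomb a b ht₂' hN₁' hN₂').eq (hcomb a' b' ht₁' hN₁' hN₂'))

theorem defPred_sameExpansion (ha : DefLattice d a) (hb : DefLattice d b) (hc : DefLattice d c)
    (K : ℕ) : DefPred d (fun v : Fin 2 → ℝ => SameExpansion K a b c (v 0) (v 1)) := by
  refine (ha (IsTerm.var _)).and ((IsTerm.var _).nonneg.and ((hb (IsTerm.var _)).and
    ((IsTerm.var _).nonneg.and (DefPred.and ?_ ?_))))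
  · iterate 6 refine DefPred.forall ?_
    refine DefPred.imp ?_ ((IsTerm.var _).sameMultiple K (IsTerm.var _) (IsTerm.var _)
      (IsTerm.var _))
    exact ((IsTerm.var _).isInitial ha hb (IsTerm.var _)).and
      (((IsTerm.var _).isMatch ha hb hc (IsTerm.var _) (IsTerm.var _) (IsTerm.var _)).and
      (((IsTerm.var _).isFirstNear ha hb (IsTerm.var _) (IsTerm.var _)).and
      ((IsTerm.var _).isFirstNear hb hc (IsTerm.var _) (IsTerm.var _))))
  · iterate 12 refine DefPred.forall ?_
    refine DefPred.imp ?_ ((IsTerm.var _).sameCombination K (IsTerm.var _) (IsTerm.var _)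
      (IsTerm.var _) (IsTerm.var _) (IsTerm.var _) (IsTerm.var _) (IsTerm.var _))
    exact ((IsTerm.var _).isNext ha hb (IsTerm.var _) (IsTerm.var _) (IsTerm.var _)).and
      (((IsTerm.var _).isMatch ha hb hc (IsTerm.var _) (IsTerm.var _) (IsTerm.var _)).and
      (((IsTerm.var _).isMatch ha hb hc (IsTerm.var _) (IsTerm.var _) (IsTerm.var _)).and
      (((IsTerm.var _).isFirstNear ha hb (IsTerm.var _) (IsTerm.var _)).and
      (((IsTerm.var _).isFirstNear hb hc (IsTerm.var _) (IsTerm.var _)).and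
      (((IsTerm.var _).isFirstNear ha hb (IsTerm.var _) (IsTerm.var _)).and
      ((IsTerm.var _).isFirstNear hb hc (IsTerm.var _) (IsTerm.var _)))))))

end

end Definability

section Approximation

variable {α : ℝ} {d : ℚ}

/-- `|k α - n|` is minimal among all `|k' α - n'|` with `0 < n' ≤ n`. -/
def IsRecord (α : ℝ) (n k : ℤ) : Prop :=
  0 < n ∧ ∀ n' k' : ℤ, 0 < n' → n' ≤ n → |k * α - n| ≤ |k' * α - n'|

theorem irrational_int_mul_sub_ne_zero (hα : Irrational α) {n k : ℤ} (hn : n ≠ 0) :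
    (k : ℝ) * α - n ≠ 0 := by
  intro h
  rcases eq_or_ne k 0 with rfl | hk
  · apply hn
    have : (n : ℝ) = 0 := by simpa using h
    exact_mod_cast this
  · exact ((hα.intCast_mul hk).ne_int n) (by linarith)

theorem eq_of_int_mul_sub_eq (hα : Irrational α) {n k n' k' : ℤ}
    (h : (k : ℝ) * α - n = k' * α - n') : n = n' := by
  by_contra hne
  refine irrational_int_mul_sub_ne_zero hα (n := n - n') (k := k - k') (sub_ne_zero.2 hne) ?_
  push_cast
  linarith

theorem exists_abs_int_mul_sub_lt (h1 : 1 < α) (h2 : α < 2) {M : ℤ} (hM : 0 < M) :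
    ∃ n k : ℤ, 0 < n ∧ n ≤ M ∧ |k * α - n| * M < 2 := by
  lift M to ℕ using hM.le
  obtain ⟨k, n, hn, hnM, h⟩ := Real.exists_int_int_abs_mul_sub_le α⁻¹ (n := M)
    (by exact_mod_cast hM)
  refine ⟨n, k, hn, hnM, ?_⟩
  have h0 : 0 < α := by linarith
  have hM' : (0 : ℝ) < M := by exact_mod_cast hM
  have e : (k : ℝ) * α - n = -(α * (n * α⁻¹ - k)) := by field_simp; ring
  rw [e, abs_neg, abs_mul, abs_of_pos h0]
  rw [le_div_iff₀ (by linarith)] at h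
  have h3 := abs_nonneg ((n : ℝ) * α⁻¹ - k)
  push_cast
  nlinarith

theorem IsRecord.abs_mul_lt (h1 : 1 < α) (h2 : α < 2) {n k : ℤ} (h : IsRecord α n k) :
    |k * α - n| * n < 2 := by
  obtain ⟨n', k', hn', hle, hlt⟩ := exists_abs_int_mul_sub_lt h1 h2 h.1
  have := h.2 n' k' hn' hle
  have hn : (0 : ℝ) < n := by exact_mod_cast h.1
  nlinarith

theorem IsRecord.one_le (h1 : 1 < α) (h2 : α < 2) (hα : Irrational α) (hd : α * α = d)
    {n k : ℤ} (h : IsRecord α n k) : 1 ≤ |k * α - n| * (3 * d.den * n) := by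
  have hn : (0 : ℝ) < n := by exact_mod_cast h.1
  have hn1 : (1 : ℝ) ≤ n := by exact_mod_cast h.1
  have hle : |(k : ℝ) * α - n| ≤ 1 := by
    have := h.2 1 1 one_pos h.1
    have h3 : |((1 : ℤ) : ℝ) * α - (1 : ℤ)| ≤ 1 := by
      push_cast
      rw [abs_le]
      constructor <;> linarith
    linarith
  have hq : (0 : ℝ) < d.den := by exact_mod_cast d.den_pos
  have hprod : ((k : ℝ) * α - n) * (k * α + n) * d.den =
      ((k ^ 2 * d.num - n ^ 2 * d.den : ℤ) : ℝ) := by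
    have : (d : ℝ) * d.den = d.num := by exact_mod_cast Rat.mul_den_eq_num d
    push_cast
    rw [← this, ← hd]
    ring
  have hne : (k ^ 2 * d.num - n ^ 2 * d.den : ℤ) ≠ 0 := by
    intro h0
    rw [h0, Int.cast_zero] at hprod
    rcases mul_eq_zero.1 hprod with h4 | h4
    · rcases mul_eq_zero.1 h4 with h5 | h5
      · exact irrational_int_mul_sub_ne_zero hα h.1.ne' h5
      · refine irrational_int_mul_sub_ne_zero hα (n := -n) (k := k) (neg_ne_zero.2 h.1.ne') ?_
        push_cast
        linarith
    · exact hq.ne' h4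
  have habs : (1 : ℝ) ≤ |((k ^ 2 * d.num - n ^ 2 * d.den : ℤ) : ℝ)| := by
    exact_mod_cast Int.one_le_abs hne
  rw [← hprod, abs_mul, abs_mul, abs_of_pos hq] at habs
  have hplus : |(k : ℝ) * α + n| ≤ 3 * n := by
    have e : (k : ℝ) * α + n = (k * α - n) + 2 * n := by ring
    rw [e]
    refine (abs_add_le _ _).trans ?_
    rw [abs_of_pos (by linarith : (0 : ℝ) < 2 * n)]
    linarith
  have h6 : |(k : ℝ) * α - n| * |(k : ℝ) * α + n| ≤ |(k : ℝ) * α - n| * (3 * n) :=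
    mul_le_mul_of_nonneg_left hplus (abs_nonneg _)
  nlinarith

theorem IsRecord.exists_next (h1 : 1 < α) (h2 : α < 2) (hα : Irrational α) (hd : α * α = d)
    {n k : ℤ} (h : IsRecord α n k) :
    ∃ n' k' : ℤ, IsRecord α n' k' ∧ n < n' ∧ n' ≤ 6 * d.den * n ∧
      |k' * α - n'| < |k * α - n| ∧ ((k : ℝ) * α - n) * (k' * α - n') < 0 := by
  have h0 : 0 < α := by linarith
  have hn : (0 : ℝ) < n := by exact_mod_cast h.1
  have hq : (0 : ℝ) < d.den := by exact_mod_cast d.den_pos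
  have hex : ∃ m : ℕ, 0 < m ∧ (m : ℤ) ≤ 6 * d.den * n ∧ ∃ k' : ℤ, |k' * α - m| < |k * α - n| := by
    have hM : 0 < 6 * (d.den : ℤ) * n := by
      have := h.1
      have := d.den_pos
      positivity
    obtain ⟨m, l, hm, hmM, hlt⟩ := exists_abs_int_mul_sub_lt h1 h2 hM
    lift m to ℕ using hm.le
    refine ⟨m, by exact_mod_cast hm, hmM, l, ?_⟩
    have := h.one_le h1 h2 hα hd
    push_cast at hlt
    have hpos : 0 < 3 * (d.den : ℝ) * n := by positivity
    refine lt_of_mul_lt_mul_right (a := 3 * (d.den : ℝ) * n) ?_ hpos.le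
    linarith
  classical
  obtain ⟨m, ⟨hm, hmM, l, hl⟩, hfind⟩ : ∃ m : ℕ, (0 < m ∧ (m : ℤ) ≤ 6 * d.den * n ∧
      ∃ k' : ℤ, |k' * α - m| < |k * α - n|) ∧ ∀ s < m, ¬ (0 < s ∧ (s : ℤ) ≤ 6 * d.den * n ∧
      ∃ k' : ℤ, |k' * α - s| < |k * α - n|) :=
    ⟨Nat.find hex, Nat.find_spec hex, fun s => Nat.find_min hex⟩
  have hmin : ∀ n' k' : ℤ, 0 < n' → n' < m → |(k : ℝ) * α - n| ≤ |k' * α - n'| := by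
    intro n' k' hn' hlt
    lift n' to ℕ using hn'.le
    have := hfind n' (by exact_mod_cast hlt)
    push Not at this
    exact this (by exact_mod_cast hn') (by lia) k'
  have hround : ∀ k' : ℤ, |(round ((m : ℝ) / α) : ℝ) * α - m| ≤ |k' * α - m| := by
    intro k'
    have := round_le ((m : ℝ) / α) k'
    have e : ∀ x : ℝ, |x * α - m| = |m / α - x| * α := by
      intro x
      have : |(m : ℝ) / α - x| * α = |(m / α - x) * α| := by rw [abs_mul, abs_of_pos h0]
      rw [this, sub_mul, div_mul_cancel₀ _ h0.ne', abs_sub_comm]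
    rw [e, e]
    exact mul_le_mul_of_nonneg_right this h0.le
  have hlt : |(round ((m : ℝ) / α) : ℝ) * α - m| < |k * α - n| := (hround l).trans_lt hl
  have hrec : IsRecord α m (round ((m : ℝ) / α)) := by
    refine ⟨by exact_mod_cast hm, fun n' k' hn' hle => ?_⟩
    rcases hle.lt_or_eq with h3 | rfl
    · push_cast
      exact hlt.le.trans (hmin n' k' hn' h3)
    · push_cast
      exact hround k'
  have hnm : n < m := by
    by_contra hcon
    have := h.2 m (round ((m : ℝ) / α)) (by exact_mod_cast hm) (not_lt.1 hcon)
    push_cast at this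
    linarith
  refine ⟨m, round ((m : ℝ) / α), hrec, hnm, hmM, by exact_mod_cast hlt, ?_⟩
  by_contra hcon
  have h3 := hmin (m - n) (round ((m : ℝ) / α) - k) (by lia) (by have := h.1; lia)
  push_cast at h3 hcon
  have e : ((round ((m : ℝ) / α) : ℝ) - k) * α - (m - n) =
    (round ((m : ℝ) / α) * α - m) - (k * α - n) := by ring
  rw [e] at h3
  have hx := irrational_int_mul_sub_ne_zero hα (k := round ((m : ℝ) / α)) (n := m) (by lia)
  push_cast at hx
  generalize (round ((m : ℝ) / α) : ℝ) * α - m = x at *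
  generalize (k : ℝ) * α - n = y at *
  rcases lt_or_gt_of_ne hx with hx | hx <;> rcases le_total y 0 with hy | hy
  · rw [abs_of_neg hx, abs_of_nonpos hy] at hlt
    rw [abs_of_nonpos hy, abs_of_nonneg (by linarith)] at h3
    linarith
  · rcases hy.eq_or_lt with hy | hy
    · rw [← hy, abs_zero] at hlt
      linarith [abs_nonneg x]
    · nlinarith
  · rcases hy.eq_or_lt with hy | hy
    · rw [hy, abs_zero] at hlt
      linarith [abs_nonneg x]
    · nlinarith
  · rw [abs_of_pos hx, abs_of_nonneg hy] at hlt
    rw [abs_of_nonneg hy, abs_of_nonpos (by linarith)] at h3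
    linarith

theorem IsRecord.lt_of_lt {n k n' k' : ℤ} (h : IsRecord α n k) (h' : IsRecord α n' k')
    (hlt : |k' * α - n'| < |k * α - n|) : n < n' := by
  by_contra hcon
  exact absurd (h.2 n' k' h'.1 (not_lt.1 hcon)) (not_le.2 hlt)

theorem IsRecord.two_mul_le {n k n' k' : ℤ} (h : IsRecord α n k) (h' : IsRecord α n' k')
    (hpos : 0 < k' * α - n') (hlt : k' * α - n' < k * α - n) :
    2 * (k' * α - n') ≤ k * α - n := by
  have hnn : n < n' := h.lt_of_lt h' (by rwa [abs_of_pos hpos, abs_of_pos (hpos.trans hlt)])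
  have := h'.2 (n' - n) (k' - k) (by lia) (by have := h.1; lia)
  push_cast at this
  rw [abs_of_pos hpos, show ((k' : ℝ) - k) * α - (n' - n) = (k' * α - n') - (k * α - n) by ring,
    abs_of_neg (by linarith)] at this
  linarith

theorem isRecord_one_one (h1 : 1 < α) (h2 : α < 2) : IsRecord α 1 1 := by
  refine ⟨one_pos, fun n k hn hle => ?_⟩
  obtain rfl : n = 1 := by lia
  push_cast
  rw [abs_of_pos (by linarith)]
  rcases le_or_gt k 0 with hk | hk
  · have : (k : ℝ) ≤ 0 := by exact_mod_cast hk
    rw [abs_of_neg (by nlinarith)]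
    nlinarith
  · have : (1 : ℝ) ≤ k := by exact_mod_cast hk
    rw [abs_of_nonneg (by nlinarith)]
    nlinarith

/-- `t` is the least natural number such that `x - t` lies in `[0, j)` modulo `ℤ α`. -/
def IsFirst (α : ℝ) (x : ℤ) (j : ℝ) (t : ℤ) : Prop :=
  0 ≤ t ∧ (∃ k : ℤ, (t : ℝ) + k * α ≤ x ∧ (x : ℝ) < t + k * α + j) ∧
    ∀ s : ℤ, 0 ≤ s → s < t → ¬ ∃ k : ℤ, (s : ℝ) + k * α ≤ x ∧ (x : ℝ) < s + k * α + j

theorem exists_isFirst {x : ℤ} (hx : 0 ≤ x) {j : ℝ} (hj : 0 < j) : ∃ t, IsFirst α x j t := by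
  classical
  have hex : ∃ t : ℕ, ∃ k : ℤ, ((t : ℤ) : ℝ) + k * α ≤ x ∧ (x : ℝ) < (t : ℤ) + k * α + j := by
    lift x to ℕ using hx
    exact ⟨x, 0, by simp, by simpa using hj⟩
  refine ⟨Nat.find hex, by positivity, Nat.find_spec hex, fun s hs hlt => ?_⟩
  lift s to ℕ using hs
  exact Nat.find_min hex (by exact_mod_cast hlt)

theorem IsFirst.unique {x t s : ℤ} {j : ℝ} (ht : IsFirst α x j t) (hs : IsFirst α x j s) :
    t = s := by
  rcases lt_trichotomy t s with h | h | h
  · exact absurd ht.2.1 (hs.2.2 t ht.1 h)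
  · exact h
  · exact absurd hs.2.1 (ht.2.2 s hs.1 h)

theorem IsFirst.le (h1 : 1 < α) (h2 : α < 2) (hα : Irrational α) (hd : α * α = d)
    {x t n k : ℤ} (hrec : IsRecord α n k) (hpos : 0 < k * α - n)
    (ht : IsFirst α x (k * α - n) t) : t ≤ (1 + 6 * d.den) * n := by
  obtain ⟨n', k', hrec', -, hle, habs, hsign⟩ := hrec.exists_next h1 h2 hα hd
  have hneg : (k' : ℝ) * α - n' < 0 := by
    by_contra hcon
    nlinarith
  rw [abs_of_neg hneg, abs_of_pos hpos] at habs
  by_contra hcon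
  have htn : n' + n < t := by lia
  obtain ⟨-, ⟨l, hl1, hl2⟩, hmin⟩ := ht
  have hn := hrec.1
  have hn' := hrec'.1
  rcases lt_or_ge ((x : ℝ) - t - l * α - (k' * α - n')) (k * α - n) with h3 | h3
  · refine hmin (t - n') (by lia) (by lia) ⟨l + k', ?_, ?_⟩ <;> push_cast <;> linarith
  · refine hmin (t - n' - n) (by lia) (by lia) ⟨l + k' + k, ?_, ?_⟩ <;> push_cast <;> linarith

theorem IsRecord.isFirst_self {x n k : ℤ} (hrec : IsRecord α n k) (hpos : 0 < k * α - n)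
    (hx : 0 ≤ x) (hxn : x ≤ n) : IsFirst α x (k * α - n) x := by
  refine ⟨hx, ⟨0, by simp, by simpa using hpos⟩, fun s hs hlt => ?_⟩
  rintro ⟨l, hl1, hl2⟩
  have := hrec.2 (x - s) l (by lia) (by lia)
  push_cast at this
  rw [abs_of_pos hpos, abs_of_nonpos (by linarith)] at this
  linarith

theorem IsRecord.exists_next_pos (h1 : 1 < α) (h2 : α < 2) (hα : Irrational α) (hd : α * α = d)
    {n k : ℤ} (h : IsRecord α n k) (hpos : 0 < k * α - n) :
    ∃ n' k' : ℤ, IsRecord α n' k' ∧ 0 < k' * α - n' ∧ n < n' ∧ n' ≤ (6 * d.den) ^ 2 * n := by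
  obtain ⟨m, l, hm, hnm, hmn, -, hs⟩ := h.exists_next h1 h2 hα hd
  obtain ⟨n', k', hn', hmn', hnm', -, hs'⟩ := hm.exists_next h1 h2 hα hd
  refine ⟨n', k', hn', ?_, hnm.trans hmn', ?_⟩
  · have : (l : ℝ) * α - m < 0 := by
      by_contra hcon
      nlinarith
    by_contra hcon
    nlinarith
  · have : (0 : ℤ) < d.den := by exact_mod_cast d.den_pos
    nlinarith

theorem exists_record_gt (h1 : 1 < α) (h2 : α < 2) (hα : Irrational α) (hd : α * α = d)
    (x : ℕ) : ∃ n k : ℤ, IsRecord α n k ∧ 0 < k * α - n ∧ x ≤ n := by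
  induction x with
  | zero => exact ⟨1, 1, isRecord_one_one h1 h2, by push_cast; linarith, by simp⟩
  | succ x ih =>
    obtain ⟨n, k, hrec, hpos, hle⟩ := ih
    obtain ⟨n', k', hrec', hpos', hlt, -⟩ := hrec.exists_next_pos h1 h2 hα hd hpos
    exact ⟨n', k', hrec', hpos', by push_cast; lia⟩

theorem IsRecord.abs_le_of_lt {n k n' k' : ℤ} (h : IsRecord α n k) (h' : IsRecord α n' k')
    (hlt : n < n') : |k' * α - n'| ≤ |k * α - n| :=
  h'.2 n k h.1 hlt.le

/-- Cramer's rule for the successive values of `IsFirst` with respect to two consecutive records;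
the coefficients are bounded. -/
theorem exists_combination (h1 : 1 < α) (h2 : α < 2) (hα : Irrational α) (hd : α * α = d)
    {x n₁ k₁ n₂ k₂ t₁ t₂ : ℤ} (hr₁ : IsRecord α n₁ k₁) (hp₁ : 0 < k₁ * α - n₁)
    (hr₂ : IsRecord α n₂ k₂) (hp₂ : 0 < k₂ * α - n₂) (hlt : n₁ < n₂)
    (hle : n₂ ≤ (6 * d.den) ^ 2 * n₁) (ht₁ : IsFirst α x (k₁ * α - n₁) t₁)
    (ht₂ : IsFirst α x (k₂ * α - n₂) t₂) {K : ℤ}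
    (hK : 4 * (1 + 6 * d.den) * (1 + (6 * d.den) ^ 2) ≤ K) :
    ∃ D a b : ℤ, 0 < D ∧ D ≤ K ∧ |a| ≤ K ∧ |b| ≤ K ∧ D * (t₂ - t₁) = a * n₁ + b * n₂ := by
  have hb₁ := ht₁.le h1 h2 hα hd hr₁ hp₁
  have hb₂ := ht₂.le h1 h2 hα hd hr₂ hp₂
  have hj := hr₁.abs_le_of_lt hr₂ hlt
  have hm₁ := hr₁.abs_mul_lt h1 h2
  have hm₂ := hr₂.abs_mul_lt h1 h2
  rw [abs_of_pos hp₁] at hm₁ hj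
  rw [abs_of_pos hp₂] at hm₂ hj
  obtain ⟨ht₁0, ⟨l₁, hl₁, hl₁'⟩, -⟩ := ht₁
  obtain ⟨ht₂0, ⟨l₂, hl₂, hl₂'⟩, -⟩ := ht₂
  have hn₁ : (0 : ℝ) < n₁ := by exact_mod_cast hr₁.1
  have hn₂ : (0 : ℝ) < n₂ := by exact_mod_cast hr₂.1
  have hltR : (n₁ : ℝ) < n₂ := by exact_mod_cast hlt
  set C : ℝ := 6 * d.den with hC
  have hC1 : 6 ≤ C := by
    have : (1 : ℝ) ≤ d.den := by exact_mod_cast d.den_pos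
    linarith
  have hleR : (n₂ : ℝ) ≤ C ^ 2 * n₁ := by rw [hC]; exact_mod_cast hle
  have hb₁R : (t₁ : ℝ) ≤ (1 + C) * n₁ := by rw [hC]; exact_mod_cast hb₁
  have hb₂R : (t₂ : ℝ) ≤ (1 + C) * n₂ := by rw [hC]; exact_mod_cast hb₂
  have hKR : 4 * (1 + C) * (1 + C ^ 2) ≤ (K : ℝ) := by rw [hC]; exact_mod_cast hK
  have ht₁R : (0 : ℝ) ≤ t₁ := by exact_mod_cast ht₁0
  have ht₂R : (0 : ℝ) ≤ t₂ := by exact_mod_cast ht₂0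
  have hscale : ∀ z : ℤ, |α * z| ≤ K → |z| ≤ K := by
    intro z hz
    have : |(z : ℝ)| ≤ K := by
      rw [abs_mul, abs_of_pos (by linarith)] at hz
      nlinarith [abs_nonneg (z : ℝ)]
    exact_mod_cast this
  obtain ⟨j₁, hj₁⟩ : ∃ j : ℝ, j = k₁ * α - n₁ := ⟨_, rfl⟩
  obtain ⟨j₂, hj₂⟩ : ∃ j : ℝ, j = k₂ * α - n₂ := ⟨_, rfl⟩
  obtain ⟨h, hh⟩ : ∃ h : ℝ, h = (t₂ - t₁) - (l₁ - l₂) * α := ⟨_, rfl⟩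
  rw [← hj₁] at hp₁ hj hm₁ hl₁'
  rw [← hj₂] at hp₂ hj hm₂ hl₂'
  have hhb : |h| ≤ j₁ := by
    rw [abs_le]
    constructor <;> linarith
  have hC2 : 0 ≤ C ^ 2 := sq_nonneg C
  have hm : |(t₂ : ℝ) - t₁| ≤ (1 + C) * n₂ := by
    have : (1 + C) * n₁ ≤ (1 + C) * n₂ := mul_le_mul_of_nonneg_left hltR.le (by linarith)
    rw [abs_le]
    constructor <;> linarith
  have hn₁j₁ : n₁ * j₁ ≤ 2 := by linarith
  have hn₂j₁ : n₂ * j₁ ≤ 2 * C ^ 2 := by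
    have h3 : n₂ * j₁ ≤ C ^ 2 * n₁ * j₁ := mul_le_mul_of_nonneg_right hleR hp₁.le
    have h4 : C ^ 2 * (n₁ * j₁) ≤ C ^ 2 * 2 := mul_le_mul_of_nonneg_left hn₁j₁ hC2
    linarith
  have hmj₁ : |((t₂ : ℝ) - t₁) * j₁| ≤ (1 + C) * (2 * C ^ 2) := by
    rw [abs_mul, abs_of_pos hp₁]
    have h3 : |(t₂ : ℝ) - t₁| * j₁ ≤ (1 + C) * n₂ * j₁ := mul_le_mul_of_nonneg_right hm hp₁.le
    have h4 := mul_le_mul_of_nonneg_left hn₂j₁ (by linarith : 0 ≤ 1 + C)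
    linarith
  have hmj₂ : |((t₂ : ℝ) - t₁) * j₂| ≤ (1 + C) * (2 * C ^ 2) := by
    refine le_trans ?_ hmj₁
    rw [abs_mul, abs_mul, abs_of_pos hp₂, abs_of_pos hp₁]
    exact mul_le_mul_of_nonneg_left hj (abs_nonneg _)
  have hn₂h : |n₂ * h| ≤ 2 * C ^ 2 := by
    rw [abs_mul, abs_of_pos hn₂]
    exact (mul_le_mul_of_nonneg_left hhb hn₂.le).trans hn₂j₁
  have hn₁h : |n₁ * h| ≤ 2 * C ^ 2 := by
    refine le_trans ?_ hn₂h
    rw [abs_mul, abs_mul, abs_of_pos hn₂, abs_of_pos hn₁]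
    exact mul_le_mul_of_nonneg_right hltR.le (abs_nonneg _)
  have hfinal : (1 + C) * (2 * C ^ 2) + 2 * C ^ 2 ≤ K := by
    have : 0 ≤ C * C ^ 2 := mul_nonneg (by linarith) hC2
    linarith
  have hDα : α * ((k₁ * n₂ - n₁ * k₂ : ℤ) : ℝ) = n₂ * j₁ - n₁ * j₂ := by
    push_cast
    rw [hj₁, hj₂]
    ring
  have hDpos : 0 < n₂ * j₁ - n₁ * j₂ := by
    have h3 := mul_le_mul_of_nonneg_left hj hn₁.le
    have h4 := mul_lt_mul_of_pos_right hltR hp₁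
    linarith
  refine ⟨k₁ * n₂ - n₁ * k₂, (l₁ - l₂) * n₂ - (t₂ - t₁) * k₂, k₁ * (t₂ - t₁) - n₁ * (l₁ - l₂),
    ?_, ?_, ?_, ?_, by ring⟩
  · have : 0 < α * ((k₁ * n₂ - n₁ * k₂ : ℤ) : ℝ) := by rwa [hDα]
    exact_mod_cast (mul_pos_iff_of_pos_left (by linarith)).1 this
  · refine (le_abs_self _).trans (hscale _ ?_)
    rw [hDα, abs_of_pos hDpos]
    have : 0 ≤ (1 + C) * (2 * C ^ 2) := mul_nonneg (by linarith) (by linarith)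
    linarith [mul_pos hn₁ hp₂]
  · apply hscale
    have e : α * (((l₁ - l₂) * n₂ - (t₂ - t₁) * k₂ : ℤ) : ℝ) =
        -(((t₂ : ℝ) - t₁) * j₂) - n₂ * h := by
      push_cast
      rw [hj₂, hh]
      ring
    rw [e]
    refine (abs_sub _ _).trans ?_
    rw [abs_neg]
    linarith
  · apply hscale
    have e : α * ((k₁ * (t₂ - t₁) - n₁ * (l₁ - l₂) : ℤ) : ℝ) =
        ((t₂ : ℝ) - t₁) * j₁ + n₁ * h := by
      push_cast
      rw [hj₁, hh]
      ring
    rw [e]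
    refine (abs_add_le _ _).trans ?_
    linarith

end Approximation

section Scaling

variable {α a b : ℝ}

theorem inLattice_mul (hα : 0 < α) {c x : ℝ} : InLattice (α * c) (α * x) ↔ InLattice c x := by
  refine exists_congr fun z => ?_
  rw [mul_left_comm, mul_right_inj' hα.ne']

theorem forall_mul_iff (hα : 0 < α) {P : ℝ → Prop} : (∀ x, P x) ↔ ∀ x, P (α * x) :=
  ⟨fun h x => h _, fun h x => by simpa [mul_div_cancel₀ _ hα.ne'] using h (x / α)⟩

theorem exists_mul_iff (hα : 0 < α) {P : ℝ → Prop} : (∃ x, P x) ↔ ∃ x, P (α * x) :=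
  ⟨fun ⟨x, h⟩ => ⟨x / α, by rwa [mul_div_cancel₀ _ hα.ne']⟩, fun ⟨x, h⟩ => ⟨_, h⟩⟩

theorem isApprox_mul (hα : 0 < α) {N j : ℝ} :
    IsApprox (α * a) (α * b) (α * N) (α * j) ↔ IsApprox a b N j := by
  rw [IsApprox, IsApprox, forall_mul_iff hα, ← mul_add]
  refine and_congr (inLattice_mul hα) (and_congr (mul_pos_iff_of_pos_left hα)
    (and_congr (mul_pos_iff_of_pos_left hα) (and_congr (inLattice_mul hα)
      (forall_congr' fun M => ?_))))
  rw [forall_mul_iff hα]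
  simp only [← mul_add, inLattice_mul hα, mul_pos_iff_of_pos_left hα, mul_le_mul_iff_right₀ hα]

theorem isNear_mul (hα : 0 < α) {x j t : ℝ} :
    IsNear (α * b) (α * x) (α * j) (α * t) ↔ IsNear b x j t := by
  rw [IsNear, exists_mul_iff hα]
  simp only [← mul_add, inLattice_mul hα, mul_le_mul_iff_right₀ hα, mul_lt_mul_iff_right₀ hα,
    IsNear]

theorem isFirstNear_mul (hα : 0 < α) {x j t : ℝ} :
    IsFirstNear (α * a) (α * b) (α * x) (α * j) (α * t) ↔ IsFirstNear a b x j t := by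
  simp only [IsFirstNear]
  rw [forall_mul_iff hα (P := fun s => InLattice (α * a) s ∧ 0 ≤ s ∧ s < α * t →
    ¬ IsNear (α * b) (α * x) (α * j) s)]
  simp only [inLattice_mul hα, isNear_mul hα, mul_nonneg_iff_of_pos_left hα,
    mul_lt_mul_iff_right₀ hα]

theorem isApprox_mul_self (hα : 0 < α) {N j : ℝ} :
    IsApprox α (α * α) (α * N) (α * j) ↔ IsApprox 1 α N j := by
  simpa using isApprox_mul hα (a := 1) (b := α) (N := N) (j := j)

theorem isFirstNear_mul_self (hα : 0 < α) {x j t : ℝ} :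
    IsFirstNear α (α * α) (α * x) (α * j) (α * t) ↔ IsFirstNear 1 α x j t := by
  simpa using isFirstNear_mul hα (a := 1) (b := α) (x := x) (j := j) (t := t)

end Scaling

section Main

variable {α : ℝ} {d : ℚ}

theorem isApprox_iff {N j : ℝ} : IsApprox 1 α N j ↔
    ∃ n k : ℤ, N = n ∧ j = k * α - n ∧ IsRecord α n k ∧ 0 < k * α - n := by
  constructor
  · rintro ⟨⟨n, rfl⟩, hN, hj, ⟨k, hk⟩, h⟩
    simp only [mul_one] at *
    obtain rfl : j = k * α - n := by linarith
    refine ⟨n, k, rfl, rfl, ⟨by exact_mod_cast hN, fun n' k' hn' hle => ?_⟩, hj⟩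
    rw [abs_of_pos hj]
    rcases h n' (k' * α) ⟨⟨n', by simp⟩, ⟨k', rfl⟩, by exact_mod_cast hn',
      by exact_mod_cast hle⟩ with h | h
    · exact le_abs.2 (Or.inr (by linarith))
    · exact le_abs.2 (Or.inl (by linarith))
  · rintro ⟨n, k, rfl, rfl, ⟨hn, h⟩, hj⟩
    refine ⟨⟨n, by simp⟩, by exact_mod_cast hn, hj, ⟨k, by ring⟩, ?_⟩
    rintro _ _ ⟨⟨n', rfl⟩, ⟨k', rfl⟩, hn', hle⟩
    simp only [mul_one] at *
    have := h n' k' (by exact_mod_cast hn') (by exact_mod_cast hle)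
    rw [abs_of_pos hj] at this
    rcases le_abs.1 this with h | h
    · exact Or.inr (by linarith)
    · exact Or.inl (by linarith)

theorem isFirstNear_iff {x : ℤ} {j t : ℝ} :
    IsFirstNear 1 α x j t ↔ ∃ s : ℤ, t = s ∧ IsFirst α x j s := by
  have hnear : ∀ s : ℤ, IsNear α x j s ↔
      ∃ k : ℤ, (s : ℝ) + k * α ≤ x ∧ (x : ℝ) < s + k * α + j := by
    intro s
    constructor
    · rintro ⟨_, ⟨k, rfl⟩, h⟩
      exact ⟨k, h⟩
    · rintro ⟨k, h⟩
      exact ⟨_, ⟨k, rfl⟩, h⟩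
  constructor
  · rintro ⟨⟨s, rfl⟩, h0, hs, h⟩
    simp only [mul_one] at *
    refine ⟨s, rfl, by exact_mod_cast h0, (hnear s).1 hs, fun r hr hlt => ?_⟩
    rw [← hnear]
    exact h r ⟨⟨r, by simp⟩, by exact_mod_cast hr, by exact_mod_cast hlt⟩
  · rintro ⟨s, rfl, h0, hs, h⟩
    refine ⟨⟨s, by simp⟩, by exact_mod_cast h0, (hnear s).2 hs, ?_⟩
    rintro _ ⟨⟨r, rfl⟩, hr, hlt⟩
    simp only [mul_one] at *
    rw [hnear]
    exact h r (by exact_mod_cast hr) (by exact_mod_cast hlt)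

theorem isMatch_iff (h1 : 1 < α) (h2 : α < 2) (hα : Irrational α) {N j N' j' : ℝ} :
    IsMatch 1 α (α * α) N j N' j' ↔ IsApprox 1 α N j ∧ N' = α * N ∧ j' = α * j := by
  have h0 : 0 < α := by linarith
  constructor
  · rintro ⟨hA, hB, hlt, h⟩
    refine ⟨hA, ?_⟩
    obtain ⟨M, rfl⟩ : ∃ M, N' = α * M := ⟨N' / α, (mul_div_cancel₀ _ h0.ne').symm⟩
    obtain ⟨i, rfl⟩ : ∃ i, j' = α * i := ⟨j' / α, (mul_div_cancel₀ _ h0.ne').symm⟩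
    rw [isApprox_mul_self h0] at hB
    have hj := hA.2.2.1
    have hi := hB.2.2.1
    have hle : i ≤ j := by
      by_contra hcon
      refine h (α * N) (α * j) ((isApprox_mul_self h0).2 hA) ⟨by nlinarith, ?_⟩
      exact mul_lt_mul_of_pos_left (not_le.1 hcon) h0
    obtain ⟨n, k, rfl, rfl, hr, hp⟩ := isApprox_iff.1 hA
    obtain ⟨m, l, rfl, rfl, hr', hp'⟩ := isApprox_iff.1 hB
    rcases hle.lt_or_eq with hlt' | heq
    · have := hr.two_mul_le hr' hp' hlt'
      nlinarith
    · rw [heq, eq_of_int_mul_sub_eq hα heq]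
      exact ⟨rfl, rfl⟩
  · rintro ⟨hA, rfl, rfl⟩
    have hj := hA.2.2.1
    refine ⟨hA, (isApprox_mul_self h0).2 hA, by nlinarith, ?_⟩
    intro M i hB
    obtain ⟨M, rfl⟩ : ∃ M', M = α * M' := ⟨M / α, (mul_div_cancel₀ _ h0.ne').symm⟩
    obtain ⟨i, rfl⟩ : ∃ i', i = α * i' := ⟨i / α, (mul_div_cancel₀ _ h0.ne').symm⟩
    rw [isApprox_mul_self h0] at hB
    rintro ⟨hlt, hlt'⟩
    have hi := hB.2.2.1
    obtain ⟨n, k, rfl, rfl, hr, hp⟩ := isApprox_iff.1 hA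
    obtain ⟨m, l, rfl, rfl, hr', hp'⟩ := isApprox_iff.1 hB
    have := hr.two_mul_le hr' hp' (lt_of_mul_lt_mul_left hlt' h0.le)
    nlinarith

theorem SameMultiple.eq_of_mul (h0 : 0 < α) {K : ℕ} {N t t' : ℝ}
    (h : SameMultiple K N t (α * N) (α * t')) : t = t' := by
  obtain ⟨c, -, h, h'⟩ := h
  apply mul_left_cancel₀ h0.ne'
  linear_combination α * h - h'

theorem SameCombination.eq_of_mul (h0 : 0 < α) {K : ℕ} {N₁ N₂ t₁ t₂ t₂' : ℝ}
    (h : SameCombination K N₁ N₂ t₁ t₂ (α * N₁) (α * N₂) (α * t₁) (α * t₂')) : t₂ = t₂' := by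
  obtain ⟨D, -, a, -, a', -, b, -, b', -, h, h'⟩ := h
  have hD : ((D + 1 : ℕ) : ℝ) ≠ 0 := by positivity
  apply mul_left_cancel₀ (mul_ne_zero h0.ne' hD)
  linear_combination α * h - h'

theorem sameMultiple_mul {K : ℕ} {N : ℝ} {c : ℕ} (hc : c < K) :
    SameMultiple K N (c * N) (α * N) (α * (c * N)) := by
  refine ⟨c, hc, ?_, ?_⟩ <;> push_cast <;> ring

theorem sameCombination_mul {K : ℕ} {D a b n₁ n₂ t₁ t₂ : ℤ} (hD : 0 < D) (hDK : D < K)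
    (ha : |a| < K) (hb : |b| < K) (h : D * (t₂ - t₁) = a * n₁ + b * n₂) :
    SameCombination K n₁ n₂ t₁ t₂ (α * n₁) (α * n₂) (α * t₁) (α * t₂) := by
  rw [abs_lt] at ha hb
  have hR : (D : ℝ) * (t₂ - t₁) = a * n₁ + b * n₂ := by exact_mod_cast h
  have hDn : (((D.toNat - 1) + 1 : ℕ) : ℝ) = D := by
    have : (((D.toNat - 1) + 1 : ℕ) : ℤ) = D := by lia
    exact_mod_cast this
  have hsub : ∀ z : ℤ, (((-z).toNat + 1 : ℕ) : ℝ) = ((z.toNat + 1 : ℕ) : ℝ) - z := by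
    intro z
    have : (((-z).toNat + 1 : ℕ) : ℤ) = ((z.toNat + 1 : ℕ) : ℤ) - z := by lia
    exact_mod_cast this
  refine ⟨D.toNat - 1, by lia, (-a).toNat, by lia, a.toNat, by lia, (-b).toNat, by lia,
    b.toNat, by lia, ?_, ?_⟩
  · rw [hDn, hsub, hsub]
    linear_combination hR
  · rw [hDn, hsub, hsub]
    linear_combination α * hR

theorem isInitial_iff (h1 : 1 < α) (h2 : α < 2) {N j : ℝ} :
    IsInitial 1 α N j ↔ IsApprox 1 α N j ∧ N = 1 := by
  have hone : IsApprox 1 α 1 (α - 1) := isApprox_iff.2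
    ⟨1, 1, by simp, by simp, isRecord_one_one h1 h2, by push_cast; linarith⟩
  have hle : ∀ {M i : ℝ}, IsApprox 1 α M i → 1 ≤ M := by
    intro M i h
    obtain ⟨m, l, rfl, -, hr, -⟩ := isApprox_iff.1 h
    exact_mod_cast hr.1
  constructor
  · rintro ⟨hA, h⟩
    exact ⟨hA, le_antisymm (not_lt.1 (h 1 _ hone)) (hle hA)⟩
  · rintro ⟨hA, rfl⟩
    exact ⟨hA, fun M i hM => not_lt.2 (hle hM)⟩

theorem sameExpansion_of_eq (h1 : 1 < α) (h2 : α < 2) (hα : Irrational α) (hd : α * α = d)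
    {K : ℕ} (hK : 4 * (1 + 6 * d.den) * (1 + (6 * d.den) ^ 2) < K) (x : ℕ) :
    SameExpansion K 1 α (α * α) x (x * α) := by
  have h0 : 0 < α := by linarith
  have hfirst : ∀ {j t' : ℝ}, IsFirstNear α (α * α) (x * α) (α * j) t' →
      ∃ s : ℤ, t' = α * s ∧ IsFirst α x j s := by
    intro j t' h
    obtain ⟨t, rfl⟩ : ∃ t, t' = α * t := ⟨t' / α, (mul_div_cancel₀ _ h0.ne').symm⟩
    rw [mul_comm (x : ℝ), isFirstNear_mul_self h0] at h
    obtain ⟨s, rfl, hs⟩ := (isFirstNear_iff (x := (x : ℤ))).1 (by exact_mod_cast h)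
    exact ⟨s, rfl, hs⟩
  have hfirst' : ∀ {j t : ℝ}, IsFirstNear 1 α x j t → ∃ s : ℤ, t = s ∧ IsFirst α x j s :=
    fun h => (isFirstNear_iff (x := (x : ℤ))).1 (by exact_mod_cast h)
  refine ⟨⟨x, by simp⟩, by positivity, ⟨x, by simp⟩, by positivity, ?_, ?_⟩
  · rintro N j N' j' t t' ⟨hI, hM, hF, hF'⟩
    obtain ⟨-, rfl⟩ := (isInitial_iff h1 h2).1 hI
    obtain ⟨hA, rfl, rfl⟩ := (isMatch_iff h1 h2 hα).1 hM
    obtain ⟨n, k, hn, rfl, hr, hp⟩ := isApprox_iff.1 hA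
    obtain rfl : n = 1 := by exact_mod_cast hn.symm
    obtain ⟨s, rfl, hs⟩ := hfirst' hF
    obtain ⟨s', rfl, hs'⟩ := hfirst hF'
    obtain rfl := hs.unique hs'
    have hle := hs.le h1 h2 hα hd hr hp
    obtain ⟨c, rfl⟩ := Int.eq_ofNat_of_zero_le hs.1
    have hcK : c < K := by
      have : c ≤ 1 + 6 * d.den := by exact_mod_cast (by simpa using hle : (c : ℤ) ≤ 1 + 6 * d.den)
      have : (1 + 6 * d.den) ≤ (1 + 6 * d.den) * (4 * (1 + (6 * d.den) ^ 2)) :=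
        Nat.le_mul_of_pos_right _ (by positivity)
      lia
    simpa using sameMultiple_mul (α := α) (N := 1) hcK
  · rintro N₁ j₁ N₁' j₁' t₁ t₁' N₂ j₂ N₂' j₂' t₂ t₂' ⟨hN, hM₁, hM₂, hF₁, hF₁', hF₂, hF₂'⟩
    obtain ⟨hA₁, rfl, rfl⟩ := (isMatch_iff h1 h2 hα).1 hM₁
    obtain ⟨hA₂, rfl, rfl⟩ := (isMatch_iff h1 h2 hα).1 hM₂
    obtain ⟨n₁, k₁, rfl, rfl, hr₁, hp₁⟩ := isApprox_iff.1 hA₁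
    obtain ⟨n₂, k₂, rfl, rfl, hr₂, hp₂⟩ := isApprox_iff.1 hA₂
    obtain ⟨s₁, rfl, hs₁⟩ := hfirst' hF₁
    obtain ⟨s₁', rfl, hs₁'⟩ := hfirst hF₁'
    obtain rfl := hs₁.unique hs₁'
    obtain ⟨s₂, rfl, hs₂⟩ := hfirst' hF₂
    obtain ⟨s₂', rfl, hs₂'⟩ := hfirst hF₂'
    obtain rfl := hs₂.unique hs₂'
    obtain ⟨-, -, hlt, hnext⟩ := hN
    have hle : n₂ ≤ (6 * d.den) ^ 2 * n₁ := by
      obtain ⟨n, k, hr, hp, hgt, hle⟩ := hr₁.exists_next_pos h1 h2 hα hd hp₁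
      have := hnext n _ (isApprox_iff.2 ⟨n, k, rfl, rfl, hr, hp⟩)
      refine le_trans (not_lt.1 fun hcon => this ⟨?_, ?_⟩) hle
      · exact_mod_cast hgt
      · exact_mod_cast hcon
    obtain ⟨D, a, b, hD, hDK, ha, hb, h⟩ := exists_combination h1 h2 hα hd hr₁ hp₁ hr₂ hp₂
      (by exact_mod_cast hlt) hle hs₁ hs₂ le_rfl
    have hK' : 4 * (1 + 6 * (d.den : ℤ)) * (1 + (6 * d.den) ^ 2) < K := by exact_mod_cast hK
    exact sameCombination_mul hD (hDK.trans_lt hK') (ha.trans_lt hK') (hb.trans_lt hK') h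

theorem SameExpansion.exists_eq (h1 : 1 < α) (h2 : α < 2) (hα : Irrational α) (hd : α * α = d)
    {K : ℕ} {x x' : ℝ} (h : SameExpansion K 1 α (α * α) x x') :
    ∃ n : ℕ, x = n ∧ x' = n * α := by
  have h0 : 0 < α := by linarith
  obtain ⟨⟨m, rfl⟩, hm, ⟨m', rfl⟩, hm', hinit, hstep⟩ := h
  rw [mul_one] at *
  have hm : 0 ≤ m := by exact_mod_cast hm
  have hm' : 0 ≤ m' := by
    have := nonneg_of_mul_nonneg_left hm' h0
    exact_mod_cast this
  have hfirst : ∀ {j : ℝ} {s : ℤ}, IsFirst α m j s → IsFirstNear 1 α m j s :=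
    fun hs => isFirstNear_iff.2 ⟨_, rfl, hs⟩
  have hfirst' : ∀ {j : ℝ} {s : ℤ}, IsFirst α m' j s →
      IsFirstNear α (α * α) (m' * α) (α * j) (α * s) := by
    intro j s hs
    rw [mul_comm (m' : ℝ), isFirstNear_mul_self h0]
    exact isFirstNear_iff.2 ⟨_, rfl, hs⟩
  have key : ∀ (B : ℕ) (n k t t' : ℤ), n < B → IsRecord α n k → 0 < k * α - n →
      IsFirst α m (k * α - n) t → IsFirst α m' (k * α - n) t' → t = t' := by
    intro B
    induction B with
    | zero =>
      intro n k t t' hn hr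
      exact absurd hr.1 (by lia)
    | succ B ih =>
      intro n k t t' hn hr hp ht ht'
      have hA : IsApprox 1 α n (k * α - n) := isApprox_iff.2 ⟨n, k, rfl, rfl, hr, hp⟩
      have hM := (isMatch_iff h1 h2 hα).2 ⟨hA, rfl, rfl⟩
      by_cases hn1 : n = 1
      · have := hinit _ _ _ _ _ _ ⟨(isInitial_iff h1 h2).2 ⟨hA, by simp [hn1]⟩, hM, hfirst ht,
          hfirst' ht'⟩
        exact_mod_cast this.eq_of_mul h0
      · obtain ⟨n₀, ⟨hlt, k₀, hr₀, hp₀⟩, hmax⟩ := Int.exists_greatest_of_bdd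
          (P := fun z => z < n ∧ ∃ l : ℤ, IsRecord α z l ∧ 0 < l * α - z) ⟨n, fun z hz => hz.1.le⟩
          ⟨1, by have := hr.1; lia, 1, isRecord_one_one h1 h2, by push_cast; linarith⟩
        obtain ⟨s, hs⟩ := exists_isFirst hm hp₀
        obtain ⟨s', hs'⟩ := exists_isFirst hm' hp₀
        obtain rfl := ih n₀ k₀ s s' (by lia) hr₀ hp₀ hs hs'
        have hA₀ : IsApprox 1 α n₀ (k₀ * α - n₀) := isApprox_iff.2 ⟨n₀, k₀, rfl, rfl, hr₀, hp₀⟩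
        have hM₀ := (isMatch_iff h1 h2 hα).2 ⟨hA₀, rfl, rfl⟩
        have hnext : IsNext 1 α n₀ (k₀ * α - n₀) n (k * α - n) := by
          refine ⟨hA₀, hA, by exact_mod_cast hlt, fun N j hN => ?_⟩
          obtain ⟨z, l, rfl, -, hz, hl⟩ := isApprox_iff.1 hN
          rintro ⟨hlt₁, hlt₂⟩
          have := hmax z ⟨by exact_mod_cast hlt₂, l, hz, hl⟩
          exact absurd this (not_le.2 (by exact_mod_cast hlt₁))
        have := hstep _ _ _ _ _ _ _ _ _ _ _ _ ⟨hnext, hM₀, hM, hfirst hs, hfirst' hs',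
          hfirst ht, hfirst' ht'⟩
        exact_mod_cast this.eq_of_mul h0
  obtain ⟨n, k, hr, hp, hle⟩ := exists_record_gt h1 h2 hα hd (m.toNat + m'.toNat)
  have hmm : m = m' := key (n.toNat + 1) n k m m' (by lia) hr hp
    (hr.isFirst_self hp hm (by lia)) (hr.isFirst_self hp hm' (by lia))
  refine ⟨m.toNat, ?_, ?_⟩
  · exact_mod_cast (Int.toNat_of_nonneg hm).symm
  · have : ((m.toNat : ℕ) : ℝ) = m := by exact_mod_cast Int.toNat_of_nonneg hm
    rw [this, hmm]

end Main

theorem lambda_sqrt_d_definable_on_nat (d : ℚ)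
    (h1 : 1.5 < Real.sqrt d) (h2 : Real.sqrt d < 2) (hirr : Irrational (Real.sqrt d)) :
    letI := rStruc d
    Set.Definable₂ (∅ : Set ℝ) rLang
      {p : ℝ × ℝ | ∃ n : ℕ, p.1 = (n : ℝ) ∧ p.2 = (n : ℝ) * Real.sqrt d} := by
  have h1' : 1 < Real.sqrt d := by norm_num at h1 ⊢; linarith
  have hd : 0 < (d : ℝ) := Real.sqrt_pos.1 (by linarith)
  have hdd : Real.sqrt d * Real.sqrt d = d := Real.mul_self_sqrt hd.le
  refine DefPred.definable₂ (P := fun x y => ∃ n : ℕ, x = (n : ℝ) ∧ y = (n : ℝ) * Real.sqrt d) ?_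
  have hc : DefLattice d (Real.sqrt d * Real.sqrt d) := by
    rw [hdd]
    exact defLattice_ratCast (by exact_mod_cast hd)
  refine (defPred_sameExpansion defLattice_one defLattice_sqrt hc
    (4 * (1 + 6 * d.den) * (1 + (6 * d.den) ^ 2) + 1)).congr fun v => ?_
  constructor
  · exact fun h => h.exists_eq h1' h2 hirr hdd
  · rintro ⟨n, hx, hy⟩
    rw [hx, hy]
    exact sameExpansion_of_eq h1' h2 hirr hdd (Nat.lt_succ_self _) n
end

section
/- Let a > 1 be an irrational real number with continued fraction expansion [a₀; a₁, a₂, …] and convergent denominators qₖ. Then every N ∈ ℕ can be written uniquely as N = Σ_{k=0}^n b_{k+1}·qₖ, where bₖ ∈ ℕ, b₁ < a₁, bₖ ≤ aₖ for all k, and b_{k−1} = 0 whenever bₖ = aₖ. -/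
open Real

/-- The sequence of complete quotients of `a`: `ζ₀ = a`, `ζ_{k+1} = 1/(ζₖ - ⌊ζₖ⌋)`. -/
noncomputable def cfZeta (a : ℝ) : ℕ → ℝ
  | 0 => a
  | k + 1 => (cfZeta a k - ⌊cfZeta a k⌋)⁻¹

/-- The partial quotients of the continued fraction expansion `[a₀; a₁, a₂, …]` of `a`. -/
noncomputable def cfA (a : ℝ) (k : ℕ) : ℤ := ⌊cfZeta a k⌋

/-- Denominators of the convergents, shifted by one: `cfQ a (k+1) = qₖ`, with
`q₋₁ = 0`, `q₀ = 1` and `q_{k+1} = a_{k+1}·qₖ + q_{k-1}`. -/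
noncomputable def cfQ (a : ℝ) : ℕ → ℤ
  | 0 => 0
  | 1 => 1
  | k + 2 => cfA a (k + 1) * cfQ a (k + 1) + cfQ a k

/-- Numerators of the convergents, shifted by one: `cfP a (k+1) = pₖ`, with
`p₋₁ = 1`, `p₀ = a₀` and `p_{k+1} = a_{k+1}·pₖ + p_{k-1}`. -/
noncomputable def cfP (a : ℝ) : ℕ → ℤ
  | 0 => 1
  | 1 => cfA a 0
  | k + 2 => cfA a (k + 1) * cfP a (k + 1) + cfP a k

/-- The `k`-th difference `βₖ = qₖ·a − pₖ`. -/
noncomputable def cfBeta (a : ℝ) (k : ℕ) : ℝ := (cfQ a (k + 1) : ℝ) * a - (cfP a (k + 1) : ℝ)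

/-- `m` is the length of the minimal period of the continued fraction expansion of `a`
(periodicity from index 1 onward). -/
def IsMinPeriod (a : ℝ) (m : ℕ) : Prop :=
  0 < m ∧ (∀ k, 1 ≤ k → cfA a (k + m) = cfA a k) ∧
    ∀ m', 0 < m' → (∀ k, 1 ≤ k → cfA a (k + m') = cfA a k) → m ≤ m'

/-- The Ostrowski digit conditions for a digit sequence `b`, where `b k` is the coefficient
of `qₖ` (i.e. `b k` is the digit `b_{k+1}` in the classical notation): `b₁ < a₁`,
`bₖ ≤ aₖ` for all `k`, and `b_{k-1} = 0` whenever `bₖ = aₖ`. -/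
def OstrowskiDigits (a : ℝ) (b : ℕ → ℕ) : Prop :=
  (b 0 : ℤ) < cfA a 1 ∧ (∀ k : ℕ, (b k : ℤ) ≤ cfA a (k + 1)) ∧
    ∀ k : ℕ, (b (k + 1) : ℤ) = cfA a (k + 2) → b k = 0

/-- `b` is the (digit sequence of the) Ostrowski representation of `n` based on `a`:
it has finite support, satisfies the digit conditions, and `n = Σ_k b_{k+1}·qₖ`. -/
def IsOstrowskiRep (a : ℝ) (b : ℕ → ℕ) (n : ℕ) : Prop :=
  (∃ K : ℕ, ∀ k : ℕ, K ≤ k → b k = 0) ∧ OstrowskiDigits a b ∧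
    (n : ℝ) = ∑' k : ℕ, (b k : ℝ) * (cfQ a (k + 1) : ℝ)

theorem irrational_cfZeta {a : ℝ} (hirr : Irrational a) (k : ℕ) : Irrational (cfZeta a k) := by
  induction k with
  | zero => exact hirr
  | succ k ih => exact (ih.sub_intCast _).inv

theorem one_le_cfA_succ {a : ℝ} (hirr : Irrational a) (k : ℕ) : 1 ≤ cfA a (k + 1) := by
  have hpos : 0 < Int.fract (cfZeta a k) := by
    refine (Int.fract_nonneg _).lt_of_ne fun h => ?_
    exact (irrational_cfZeta hirr k).ne_int ⌊cfZeta a k⌋ (sub_eq_zero.mp h.symm)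
  have hone : 1 ≤ (Int.fract (cfZeta a k))⁻¹ :=
    (one_le_inv₀ hpos).mpr (Int.fract_lt_one _).le
  exact Int.le_floor.mpr (by exact_mod_cast hone)

theorem cfQ_add_two (a : ℝ) (k : ℕ) :
    cfQ a (k + 2) = cfA a (k + 1) * cfQ a (k + 1) + cfQ a k := rfl

theorem cfQ_nonneg_and_succ_pos {a : ℝ} (hirr : Irrational a) (k : ℕ) :
    0 ≤ cfQ a k ∧ 0 < cfQ a (k + 1) := by
  induction k with
  | zero => simp [cfQ]
  | succ k ih =>
    have := one_le_cfA_succ hirr k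
    rw [cfQ_add_two]
    exact ⟨ih.2.le, by nlinarith⟩

theorem cfQ_succ_pos {a : ℝ} (hirr : Irrational a) (k : ℕ) : 0 < cfQ a (k + 1) :=
  (cfQ_nonneg_and_succ_pos hirr k).2

theorem cfQ_add_cfQ_succ_le {a : ℝ} (hirr : Irrational a) (k : ℕ) :
    cfQ a k + cfQ a (k + 1) ≤ cfQ a (k + 2) := by
  have := one_le_cfA_succ hirr k
  have := cfQ_succ_pos hirr k
  rw [cfQ_add_two]
  nlinarith

theorem cfQ_succ_mono {a : ℝ} (hirr : Irrational a) (k : ℕ) :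
    cfQ a (k + 1) ≤ cfQ a (k + 2) := by
  linarith [cfQ_add_cfQ_succ_le hirr k, (cfQ_nonneg_and_succ_pos hirr k).1]

theorem le_cfQ_succ {a : ℝ} (hirr : Irrational a) (k : ℕ) : (k : ℤ) ≤ cfQ a (k + 1) := by
  induction k with
  | zero => exact (cfQ_succ_pos hirr 0).le
  | succ k ih =>
    cases k with
    | zero => exact cfQ_succ_pos hirr 1
    | succ k =>
      have h₁ := cfQ_add_cfQ_succ_le hirr (k + 1)
      have h₂ := cfQ_succ_pos hirr k
      push_cast at ih ⊢
      linarith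

theorem OstrowskiDigits.sum_lt {a : ℝ} (hirr : Irrational a) {b : ℕ → ℕ}
    (hb : OstrowskiDigits a b) (K : ℕ) :
    ∑ k ∈ Finset.range K, (b k : ℤ) * cfQ a (k + 1) < cfQ a (K + 1) := by
  induction K using Nat.twoStepInduction with
  | zero => simp [cfQ]
  | one => simpa [cfQ] using hb.1
  | more K ih₀ ih₁ =>
    have hq := cfQ_succ_pos hirr (K + 1)
    have hq' := cfQ_succ_pos hirr K
    rw [cfQ_add_two, Finset.sum_range_succ]
    rcases (hb.2.1 (K + 1)).eq_or_lt with h | h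
    · rw [Finset.sum_range_succ, hb.2.2 K h, h]
      push_cast
      linarith
    · have h' : (b (K + 1) : ℤ) + 1 ≤ cfA a (K + 1 + 1) := h
      nlinarith

theorem OstrowskiDigits.eq_of_sum_eq {a : ℝ} (hirr : Irrational a) {b c : ℕ → ℕ}
    (hb : OstrowskiDigits a b) (hc : OstrowskiDigits a c) (K : ℕ)
    (h : ∑ k ∈ Finset.range K, (b k : ℤ) * cfQ a (k + 1) =
      ∑ k ∈ Finset.range K, (c k : ℤ) * cfQ a (k + 1)) :
    ∀ k < K, b k = c k := by
  induction K with
  | zero => simp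
  | succ K ih =>
    have hq := cfQ_succ_pos hirr K
    have div_eq : ∀ d : ℕ → ℕ, OstrowskiDigits a d →
        (∑ k ∈ Finset.range (K + 1), (d k : ℤ) * cfQ a (k + 1)) / cfQ a (K + 1) = d K := by
      intro d hd
      have hnonneg : 0 ≤ ∑ k ∈ Finset.range K, (d k : ℤ) * cfQ a (k + 1) :=
        Finset.sum_nonneg fun k _ =>
          mul_nonneg (Int.natCast_nonneg _) (cfQ_succ_pos hirr k).le
      rw [Finset.sum_range_succ, Int.add_mul_ediv_right _ _ hq.ne',
        Int.ediv_eq_zero_of_lt hnonneg (hd.sum_lt hirr K), zero_add]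
    have hK : b K = c K := by
      have := div_eq b hb
      rw [h, div_eq c hc] at this
      exact_mod_cast this.symm
    rw [Finset.sum_range_succ, Finset.sum_range_succ, hK] at h
    intro k hk
    rcases Nat.lt_succ_iff_lt_or_eq.mp hk with hk | rfl
    · exact ih (add_right_cancel h) k hk
    · exact hK

theorem OstrowskiDigits.update {a : ℝ} (hirr : Irrational a) {b : ℕ → ℕ}
    (hb : OstrowskiDigits a b) {K d : ℕ} (hsupp : ∀ k, K + 1 ≤ k → b k = 0)
    (hd : (d : ℤ) ≤ cfA a (K + 2)) (hK : (d : ℤ) = cfA a (K + 2) → b K = 0) :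
    OstrowskiDigits a (Function.update b (K + 1) d) := by
  refine ⟨by simpa using hb.1, fun k => ?_, fun k hk => ?_⟩
  · rcases eq_or_ne k (K + 1) with rfl | hne
    · simpa using hd
    · simpa [hne] using hb.2.1 k
  · rcases eq_or_ne k K with rfl | hne
    · simp only [Function.update_self] at hk
      simpa using hK hk
    · rw [Function.update_of_ne (by omega)] at hk
      rcases eq_or_ne k (K + 1) with rfl | hne'
      · have : 1 ≤ cfA a (K + 1 + 2) := one_le_cfA_succ hirr (K + 1 + 1)
        rw [hsupp _ (by omega)] at hk
        push_cast at hk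
        omega
      · rw [Function.update_of_ne hne']
        exact hb.2.2 k hk

theorem exists_ostrowskiDigits {a : ℝ} (hirr : Irrational a) (K N : ℕ)
    (hN : (N : ℤ) < cfQ a (K + 1)) :
    ∃ b : ℕ → ℕ, (∀ k, K ≤ k → b k = 0) ∧ OstrowskiDigits a b ∧
      (N : ℤ) = ∑ k ∈ Finset.range K, (b k : ℤ) * cfQ a (k + 1) := by
  induction K using Nat.twoStepInduction generalizing N with
  | zero =>
    have hA := one_le_cfA_succ hirr
    refine ⟨0, fun _ _ => rfl, ⟨hA 0, fun k => ?_, fun _ _ => rfl⟩, ?_⟩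
    · exact zero_le_one.trans (hA k)
    · have : (N : ℤ) < 1 := hN
      simp only [Finset.range_zero, Finset.sum_empty]
      omega
  | one =>
    have hA := one_le_cfA_succ hirr
    have hN' : (N : ℤ) < cfA a 1 := by simpa [cfQ] using hN
    refine ⟨Function.update 0 0 N, fun k hk => ?_, ⟨by simpa using hN', fun k => ?_,
      fun k hk => ?_⟩, by simp [cfQ]⟩
    · simp [Function.update_of_ne (show k ≠ 0 by omega)]
    · cases k with
      | zero => simpa using hN'.le
      | succ k => simpa using zero_le_one.trans (hA (k + 1))
    · have h₁ : 1 ≤ cfA a (k + 2) := hA (k + 1)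
      have h₂ : (0 : ℤ) = cfA a (k + 2) := by simpa using hk
      omega
  | more K ih₀ ih₁ =>
    have hq := cfQ_succ_pos hirr (K + 1)
    have hmono := cfQ_succ_mono hirr K
    rw [cfQ_add_two] at hN
    obtain ⟨d, hd⟩ := Int.eq_ofNat_of_zero_le
      (Int.ediv_nonneg (Int.natCast_nonneg N) hq.le)
    obtain ⟨r, hr⟩ := Int.eq_ofNat_of_zero_le (Int.emod_nonneg (N : ℤ) hq.ne')
    have hrlt : (r : ℤ) < cfQ a (K + 1 + 1) := hr ▸ Int.emod_lt_of_pos _ hq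
    have hdecomp : (N : ℤ) = r + d * cfQ a (K + 1 + 1) := by
      rw [← hr, ← hd, mul_comm, Int.emod_add_mul_ediv]
    have hdle : (d : ℤ) ≤ cfA a (K + 2) := by
      by_contra! hlt
      have : cfA a (K + 2) + 1 ≤ d := hlt
      nlinarith
    have key : ∃ b : ℕ → ℕ, (∀ k, K + 1 ≤ k → b k = 0) ∧ OstrowskiDigits a b ∧
        ((r : ℤ) = ∑ k ∈ Finset.range (K + 1), (b k : ℤ) * cfQ a (k + 1)) ∧
        ((d : ℤ) = cfA a (K + 2) → b K = 0) := by
      rcases hdle.eq_or_lt with h | h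
      · obtain ⟨b, hs, hb, hsum⟩ := ih₀ r (by rw [hdecomp, h] at hN; linarith)
        refine ⟨b, fun k hk => hs k (by omega), hb, ?_, fun _ => hs K le_rfl⟩
        rw [Finset.sum_range_succ, hs K le_rfl, hsum]
        simp
      · obtain ⟨b, hs, hb, hsum⟩ := ih₁ r hrlt
        exact ⟨b, hs, hb, hsum, fun h' => absurd h' h.ne⟩
    obtain ⟨b, hs, hb, hsum, hK⟩ := key
    refine ⟨Function.update b (K + 1) d, fun k hk => ?_, hb.update hirr hs hdle hK, ?_⟩
    · rw [Function.update_of_ne (by omega)]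
      exact hs k (by omega)
    · rw [Finset.sum_range_succ, Function.update_self, hdecomp, hsum]
      congr 1
      refine Finset.sum_congr rfl fun k hk => ?_
      rw [Function.update_of_ne (Finset.mem_range.mp hk).ne]

theorem natCast_eq_tsum_cfQ_iff (a : ℝ) {b : ℕ → ℕ} {K : ℕ} (hs : ∀ k, K ≤ k → b k = 0)
    (N : ℕ) :
    (N : ℝ) = ∑' k : ℕ, (b k : ℝ) * (cfQ a (k + 1) : ℝ) ↔
      (N : ℤ) = ∑ k ∈ Finset.range K, (b k : ℤ) * cfQ a (k + 1) := by
  rw [tsum_eq_sum (s := Finset.range K) fun k hk => by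
    simp [hs k (not_lt.mp fun h => hk (Finset.mem_range.mpr h))]]
  exact_mod_cast Iff.rfl

theorem ostrowski_representation (a : ℝ) (ha : 1 < a) (hirr : Irrational a) (N : ℕ) :
    ∃! b : ℕ → ℕ, IsOstrowskiRep a b N := by
  obtain ⟨b, hs, hb, hsum⟩ := exists_ostrowskiDigits hirr (N + 1) N
    (lt_of_lt_of_le (by push_cast; omega) (le_cfQ_succ hirr (N + 1)))
  refine ⟨b, ⟨⟨_, hs⟩, hb, (natCast_eq_tsum_cfQ_iff a hs N).mpr hsum⟩, ?_⟩
  rintro c ⟨⟨L, hL⟩, hc, hcsum⟩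
  have hb' : ∀ k, max (N + 1) L ≤ k → b k = 0 := fun k hk => hs k (le_of_max_le_left hk)
  have hc' : ∀ k, max (N + 1) L ≤ k → c k = 0 := fun k hk => hL k (le_of_max_le_right hk)
  have heq := hc.eq_of_sum_eq hirr hb (max (N + 1) L) <|
    ((natCast_eq_tsum_cfQ_iff a hc' N).mp hcsum).symm.trans
      ((natCast_eq_tsum_cfQ_iff a hb' N).mp ((natCast_eq_tsum_cfQ_iff a hs N).mpr hsum))
  funext k
  rcases lt_or_ge k (max (N + 1) L) with hk | hk
  · exact heq k hk
  · rw [hb' k hk, hc' k hk]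
end
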